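/- Let h ≥ 1, let U ⊆ ℝ^h be an open set, and for 1 ≤ k ≤ h let C_k = (C_{k,ij}) : U → (h×h symmetric matrices over ℝ) be continuously differentiable. For each k define the (2h+2)×(2h+2) matrix-valued function N_k in block form as: block (1,2) equal to the constant row vector e_kᵀ, block (2,3) equal to C_k, block (3,4) equal to the constant column vector e_k, and all other blocks zero. Then the following are equivalent at every point of U: (i) for all a,b, ∂_a N_b − ∂_b N_a + [N_a, N_b] = 0 (flatness of the connection); (ii) the collection C_{a,ij} is totally symmetric in (a,i,j) (i.e. C_{a,bj} = C_{b,aj} for all a,b,j) and satisfies ∂_a C_{b,ij} = ∂_b C_{a,ij} for all a,b,i,j. In particular, commutativity [N_a, N_b] = 0 for all a,b is equivalent to total symmetry of C, and given total symmetry, flatness is equivalent to the integrability relation R_{i₁} C_{i₂ i₃ i₄} = R_{i₂} C_{i₁ i₃ i₄} of Theorem 1. -/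

import Mathlib

open Matrix

/-- Index type for the partition 2h+2 = 1+h+h+1. -/
abbrev Idx (h : ℕ) := Fin 1 ⊕ Fin h ⊕ Fin h ⊕ Fin 1

/-- Block index of a row/column index. -/
def blk {h : ℕ} : Idx h → Fin 4
  | .inl _ => 0
  | .inr (.inl _) => 1
  | .inr (.inr (.inl _)) => 2
  | .inr (.inr (.inr _)) => 3

/-- The constant intersection matrix Φ. -/
def Phi (R : Type*) [Ring R] (h : ℕ) : Matrix (Idx h) (Idx h) R :=
  fun i j => match i, j with
  | .inl _, .inr (.inr (.inr _)) => -1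
  | .inr (.inl a), .inr (.inr (.inl b)) => if a = b then 1 else 0
  | .inr (.inr (.inl a)), .inr (.inl b) => if a = b then -1 else 0
  | .inr (.inr (.inr _)), .inl _ => 1
  | _, _ => 0

/-- Block upper triangular: every block strictly below the block diagonal is zero. -/
def IsBUT {R : Type*} [Zero R] {h : ℕ} (M : Matrix (Idx h) (Idx h) R) : Prop :=
  ∀ i j, blk j < blk i → M i j = 0

/-- Partial derivative in the direction of the a-th coordinate. -/
noncomputable def pd {h : ℕ} (a : Fin h) (f : (Fin h → ℝ) → ℝ) : (Fin h → ℝ) → ℝ :=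
  fun x => fderiv ℝ f x (Pi.single a 1)

/-- The connection matrix of Yukawa shape: block (1,2) is the row vector e_kᵀ,
block (2,3) is C, block (3,4) is the column vector e_k, all other blocks 0. -/
noncomputable def Nmat (R : Type*) [Ring R] {h : ℕ} (kk : Fin h)
    (C : Matrix (Fin h) (Fin h) R) : Matrix (Idx h) (Idx h) R :=
  fun i j => match i, j with
  | .inl _, .inr (.inl q) => if q = kk then 1 else 0
  | .inr (.inl p), .inr (.inr (.inl q)) => C p q
  | .inr (.inr (.inl p)), .inr (.inr (.inr _)) => if p = kk then 1 else 0
  | _, _ => 0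

theorem Nmat_mul {R : Type*} [Ring R] {h : ℕ} (a b : Fin h) (A B : Matrix (Fin h) (Fin h) R) :
    Nmat R a A * Nmat R b B = fun i j => match i, j with
      | .inl _, .inr (.inr (.inl q)) => B a q
      | .inr (.inl p), .inr (.inr (.inr _)) => A p b
      | _, _ => 0 := by
  ext i j
  rcases i with i | i | i | i <;> rcases j with j | j | j | j <;>
    simp [Matrix.mul_apply, Nmat]

theorem Nmat_mul_comm_iff {R : Type*} [Ring R] {h : ℕ} (a b : Fin h)
    {A B : Matrix (Fin h) (Fin h) R} (hA : ∀ i j, A i j = A j i) (hB : ∀ i j, B i j = B j i) :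
    Nmat R a A * Nmat R b B = Nmat R b B * Nmat R a A ↔ ∀ j, A b j = B a j := by
  rw [Nmat_mul, Nmat_mul]
  constructor
  · intro H j
    exact (congrFun (congrFun H (.inl 0)) (.inr (.inr (.inl j)))).symm
  · intro H
    ext i j
    rcases i with i | i | i | i <;> rcases j with j | j | j | j <;> try rfl
    · exact (H j).symm
    · exact (hA i b).trans ((H i).trans (hB a i))

theorem pd_const {h : ℕ} (a : Fin h) (c : ℝ) (t : Fin h → ℝ) : pd a (fun _ => c) t = 0 := by
  simp [pd]

/-- The derivative part and the commutator part of the curvature live in different blocks. -/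
theorem Nmat_flat_iff {h : ℕ} (a b : Fin h) (A B : (Fin h → ℝ) → Matrix (Fin h) (Fin h) ℝ)
    (t : Fin h → ℝ) :
    (∀ i j : Idx h, pd a (fun s => Nmat ℝ b (B s) i j) t - pd b (fun s => Nmat ℝ a (A s) i j) t +
        (Nmat ℝ a (A t) * Nmat ℝ b (B t) - Nmat ℝ b (B t) * Nmat ℝ a (A t)) i j = 0) ↔
      Nmat ℝ a (A t) * Nmat ℝ b (B t) = Nmat ℝ b (B t) * Nmat ℝ a (A t) ∧
        ∀ i j, pd a (fun s => B s i j) t = pd b (fun s => A s i j) t := by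
  constructor
  · intro H
    constructor
    · ext i j
      have hij := H i j
      rw [Matrix.sub_apply] at hij
      rw [Nmat_mul, Nmat_mul] at hij ⊢
      rcases i with i | i | i | i <;> rcases j with j | j | j | j <;>
        first
        | rfl
        | simpa [Nmat, pd_const, sub_eq_zero] using hij
    · intro i j
      have hij := H (.inr (.inl i)) (.inr (.inr (.inl j)))
      rw [Matrix.sub_apply, Nmat_mul, Nmat_mul] at hij
      simpa [Nmat, sub_eq_zero] using hij
  · rintro ⟨hc, hd⟩ i j
    rw [hc, sub_self, Matrix.zero_apply, add_zero]
    rcases i with i | i | i | i <;> rcases j with j | j | j | j <;>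
      simp [Nmat, pd_const, hd]

/-- For C¹ families of symmetric matrices C_k on an open set U and the
associated Yukawa-shaped connection matrices N_k, flatness
∂_a N_b − ∂_b N_a + [N_a,N_b] = 0 is pointwise equivalent to total symmetry of C together
with ∂_a C_b = ∂_b C_a; moreover commutativity of the N's is equivalent to total symmetry
of C, and given total symmetry, flatness is equivalent to ∂_a C_b = ∂_b C_a. -/
theorem statement12 (h : ℕ) (hh : 1 ≤ h) (U : Set (Fin h → ℝ)) (hU : IsOpen U)
    (C : Fin h → (Fin h → ℝ) → Matrix (Fin h) (Fin h) ℝ)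
    (hC1 : ∀ (kk i j : Fin h), ContDiffOn ℝ 1 (fun s => C kk s i j) U)
    (hCsym : ∀ (kk : Fin h), ∀ t ∈ U, ∀ i j : Fin h, C kk t i j = C kk t j i) :
    ∀ t ∈ U,
      ((∀ a b : Fin h, ∀ i j : Idx h,
          pd a (fun s => Nmat ℝ b (C b s) i j) t -
            pd b (fun s => Nmat ℝ a (C a s) i j) t +
            (Nmat ℝ a (C a t) * Nmat ℝ b (C b t) -
              Nmat ℝ b (C b t) * Nmat ℝ a (C a t)) i j = 0) ↔
        ((∀ a b j : Fin h, C a t b j = C b t a j) ∧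
          (∀ a b i j : Fin h,
            pd a (fun s => C b s i j) t = pd b (fun s => C a s i j) t))) ∧
      ((∀ a b : Fin h,
          Nmat ℝ a (C a t) * Nmat ℝ b (C b t) =
            Nmat ℝ b (C b t) * Nmat ℝ a (C a t)) ↔
        (∀ a b j : Fin h, C a t b j = C b t a j)) ∧
      ((∀ a b j : Fin h, C a t b j = C b t a j) →
        ((∀ a b : Fin h, ∀ i j : Idx h,
            pd a (fun s => Nmat ℝ b (C b s) i j) t -
              pd b (fun s => Nmat ℝ a (C a s) i j) t +
              (Nmat ℝ a (C a t) * Nmat ℝ b (C b t) -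
                Nmat ℝ b (C b t) * Nmat ℝ a (C a t)) i j = 0) ↔
          (∀ a b i j : Fin h,
            pd a (fun s => C b s i j) t = pd b (fun s => C a s i j) t))) := by
  intro t ht
  have hcomm : ∀ a b, _ := fun a b => Nmat_mul_comm_iff a b (hCsym a t ht) (hCsym b t ht)
  simp only [Nmat_flat_iff, hcomm, forall_and]
  exact ⟨trivial, trivial, fun H => and_iff_right H⟩
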